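/- arXiv:1602.02835 — 4 statements merged into one kernel-verified Lean document; each statement's English description precedes it below -/
import Mathlib

section
/- Let N ∈ ℕ and let X, X' : D_N → ℤ be distinct. Then the eta quotients η^X and η^{X'} are distinct as functions on the upper half plane; i.e., there exists z with Im(z) > 0 such that ∏_{d|N} η(dz)^{X_d} ≠ ∏_{d|N} η(dz)^{X'_d}. -/
open Finset Complex

/-- The Dedekind eta function `η(z) = e^{πiz/12}·∏_{n≥1}(1 − e^{2πinz})`. -/
noncomputable def dedekindEta (z : ℂ) : ℂ :=
  Complex.exp (Real.pi * Complex.I * z / 12) *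
    ∏' n : ℕ, (1 - Complex.exp (2 * Real.pi * Complex.I * (n + 1) * z))

open ModularForm in
/-- The derivative at `0` of `q ↦ ∏ (1 - q ^ n)` is `-1`. -/
lemma hasDerivAt_tprod_one_sub_pow_zero :
    HasDerivAt (fun q : ℂ ↦ ∏' n : ℕ, (1 - q ^ (n + 1))) (-1) 0 := by
  have h0 : (0 : ℂ) ∈ Metric.ball (0 : ℂ) 1 := by simp
  have hval : ∏' n : ℕ, (1 - (0 : ℂ) ^ (n + 1)) = 1 := by simp
  have hterm (n : ℕ) : logDeriv (fun q : ℂ ↦ 1 - q ^ (n + 1)) 0 = if n = 0 then -1 else 0 := by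
    rcases n with _ | n <;> simp [logDeriv]
  have hlog := logDeriv_tprod_eq_tsum (f := fun n (q : ℂ) ↦ 1 - q ^ (n + 1))
    Metric.isOpen_ball h0 (by simp) (by fun_prop)
    (by simp_rw [hterm]; exact (hasSum_ite_eq 0 (-1 : ℂ)).summable)
    multipliableLocallyUniformlyOn_one_sub_pow (by simp)
  simp_rw [hterm, tsum_ite_eq, logDeriv_apply, hval, div_one] at hlog
  rw [← hlog]
  exact (differentiableOn_tprod_one_sub_pow.differentiableAt
    (Metric.isOpen_ball.mem_nhds h0)).hasDerivAt

/-- The function `x ↦ log |∏ (1 - x ^ n)|` of a real variable. -/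
noncomputable def logNormEulerProduct (x : ℝ) : ℝ :=
  Real.log ‖∏' n : ℕ, (1 - (x : ℂ) ^ (n + 1))‖

lemma logNormEulerProduct_zero : logNormEulerProduct 0 = 0 := by
  simp [logNormEulerProduct]

lemma hasDerivAt_logNormEulerProduct_zero : HasDerivAt logNormEulerProduct (-1) 0 := by
  have h := hasDerivAt_tprod_one_sub_pow_zero.clog (by simp)
  have h' := HasDerivAt.real_of_complex (z := 0) (by simpa using h)
  simpa [logNormEulerProduct, Complex.log_re] using! h'

open ModularForm in
lemma dedekindEta_eq_eta (z : ℂ) : dedekindEta z = ModularForm.eta z := by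
  simp only [dedekindEta, ModularForm.eta, eta_q_eq_cexp, Function.Periodic.qParam]
  congr 2
  push_cast
  ring

open ModularForm in
lemma dedekindEta_ne_zero {z : ℂ} (hz : 0 < z.im) : dedekindEta z ≠ 0 :=
  dedekindEta_eq_eta z ▸ eta_ne_zero hz

open ModularForm in
/-- On the imaginary axis, with `x = e ^ (2πiz)`, one has
`log |η(dz)| = (d / 24) log x + log |∏ (1 - x ^ (dn))|`. -/
lemma log_norm_dedekindEta {x : ℝ} (hx : 0 < x) (hx1 : x < 1) {d : ℕ} (hd : 0 < d) :
    Real.log ‖dedekindEta (d * (I * (-Real.log x / (2 * Real.pi) : ℝ)))‖ =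
      d / 24 * Real.log x + logNormEulerProduct (x ^ d) := by
  have hpi : (Real.pi : ℂ) ≠ 0 := by exact_mod_cast Real.pi_ne_zero
  have hexp : cexp (2 * Real.pi * I * (d * (I * (-Real.log x / (2 * Real.pi) : ℝ)))) =
      ((x ^ d : ℝ) : ℂ) := by
    have : 2 * Real.pi * I * (d * (I * (-Real.log x / (2 * Real.pi) : ℝ))) =
        ((d * Real.log x : ℝ) : ℂ) := by
      push_cast
      field_simp
      simp
    rw [this, ← Complex.ofReal_exp, mul_comm, Real.exp_mul, Real.exp_log hx, Real.rpow_natCast]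
  have hz : 0 < (d * (I * (-Real.log x / (2 * Real.pi) : ℝ)) : ℂ).im := by
    have : 0 < -Real.log x / (2 * Real.pi) :=
      div_pos (neg_pos.2 (Real.log_neg hx hx1)) (by positivity)
    simp only [← Complex.ofReal_natCast, Complex.im_ofReal_mul, Complex.I_mul_im,
      Complex.ofReal_re]
    positivity
  have hprod := eta_tprod_ne_zero hz
  rw [dedekindEta_eq_eta, ModularForm.eta, norm_mul, Real.log_mul
    (norm_ne_zero_iff.2 (Function.Periodic.qParam_ne_zero _)) (norm_ne_zero_iff.2 hprod)]
  congr 1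
  · rw [Function.Periodic.norm_qParam, Real.log_exp]
    simp only [← Complex.ofReal_natCast, Complex.im_ofReal_mul,
      Complex.I_mul_im, Complex.ofReal_re]
    field_simp
  · simp only [logNormEulerProduct, eta_q_eq_pow, hexp]

open Filter Topology in
/-- An integer combination of `log x` and the functions `log |∏ (1 - x ^ (dn))|` that vanishes on
`(0, 1)` has vanishing coefficients on the latter. -/
lemma eq_zero_of_log_add_sum_logNormEulerProduct_eq_zero {S : Finset ℕ} (hS : ∀ d ∈ S, 0 < d)
    (s : ℝ) (Y : ℕ → ℝ)
    (h : ∀ x : ℝ, 0 < x → x < 1 →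
      s * Real.log x + ∑ d ∈ S, Y d * logNormEulerProduct (x ^ d) = 0) :
    ∀ d ∈ S, Y d = 0 := by
  have hev : ∀ᶠ x : ℝ in 𝓝[>] 0, 0 < x ∧ x < 1 := Ioo_mem_nhdsGT one_pos
  have hpow {d : ℕ} (hd : 0 < d) : Tendsto (fun x : ℝ ↦ x ^ d) (𝓝[>] 0) (𝓝[>] 0) := by
    refine tendsto_nhdsWithin_iff.2 ⟨?_, hev.mono fun x hx ↦ pow_pos hx.1 d⟩
    simpa [hd.ne'] using ((continuous_pow d).tendsto (0 : ℝ)).mono_left nhdsWithin_le_nhds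
  have hlim : Tendsto logNormEulerProduct (𝓝[>] 0) (𝓝 0) := by
    simpa [logNormEulerProduct_zero] using
      hasDerivAt_logNormEulerProduct_zero.continuousAt.tendsto.mono_left nhdsWithin_le_nhds
  have hslope : Tendsto (fun x ↦ logNormEulerProduct x / x) (𝓝[>] 0) (𝓝 (-1)) := by
    simpa [logNormEulerProduct_zero, div_eq_inv_mul] using
      hasDerivAt_logNormEulerProduct_zero.tendsto_slope_zero_right
  have hs : s = 0 := by
    have hsum : Tendsto (fun x ↦ -∑ d ∈ S, Y d * logNormEulerProduct (x ^ d)) (𝓝[>] 0) (𝓝 0) := by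
      simpa using (tendsto_finsetSum S fun d hd ↦
        (hlim.comp (hpow (hS d hd))).const_mul (Y d)).neg
    refine tendsto_nhds_unique (tendsto_const_nhds.congr' ?_)
      (hsum.div_atBot Real.tendsto_log_nhdsGT_zero)
    filter_upwards [hev] with x hx
    rw [eq_div_iff (Real.log_neg hx.1 hx.2).ne]
    linarith [h x hx.1 hx.2]
  intro d
  induction d using Nat.strong_induction_on with
  | _ k ih =>
  intro hk
  have hterm : ∀ d ∈ S, Tendsto (fun x ↦ Y d * logNormEulerProduct (x ^ d) / x ^ k) (𝓝[>] 0)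
      (𝓝 (if d = k then -Y k else 0)) := by
    intro d hd
    rcases lt_trichotomy d k with hlt | rfl | hgt
    · simp [ih d hlt hd, hlt.ne]
    · simpa [mul_div_assoc] using (hslope.comp (hpow (hS d hd))).const_mul (Y d)
    · have := ((hslope.comp (hpow (hS d hd))).mul
        ((hpow (Nat.sub_pos_of_lt hgt)).mono_right nhdsWithin_le_nhds)).const_mul (Y d)
      simp only [mul_zero] at this
      rw [if_neg hgt.ne']
      refine this.congr' ?_
      filter_upwards [hev] with x hx
      have hx0 := hx.1.ne'
      simp only [Function.comp_apply]
      rw [pow_sub₀ x hx0 hgt.le]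
      field_simp
  have hsum := tendsto_finsetSum S hterm
  rw [Finset.sum_ite_eq' S k, if_pos hk] at hsum
  have hzero : Tendsto (fun x ↦ ∑ d ∈ S, Y d * logNormEulerProduct (x ^ d) / x ^ k) (𝓝[>] 0)
      (𝓝 0) := by
    refine tendsto_const_nhds.congr' ?_
    filter_upwards [hev] with x hx
    have := h x hx.1 hx.2
    rw [hs, zero_mul, zero_add] at this
    rw [← Finset.sum_div, this, zero_div]
  exact neg_eq_zero.1 (tendsto_nhds_unique hsum hzero)

lemma log_norm_prod_dedekindEta_zpow {S : Finset ℕ} (hS : ∀ d ∈ S, 0 < d) (X : ℕ → ℤ) {z : ℂ}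
    (hz : 0 < z.im) :
    Real.log ‖∏ d ∈ S, dedekindEta (d * z) ^ X d‖ =
      ∑ d ∈ S, X d * Real.log ‖dedekindEta (d * z)‖ := by
  rw [norm_prod, Real.log_prod]
  · simp [norm_zpow, Real.log_zpow]
  · intro d hd
    have hdz : 0 < ((d : ℂ) * z).im := by
      have : (0 : ℝ) < d := by exact_mod_cast hS d hd
      simpa using mul_pos this hz
    exact norm_ne_zero_iff.2 (zpow_ne_zero _ (dedekindEta_ne_zero hdz))

/-- Distinct exponent vectors `X, X' : D_N → ℤ` give distinct eta quotients as
functions on the upper half plane. -/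
theorem eta_quotients_distinct (N : ℕ) (hN : 0 < N) (X X' : ℕ → ℤ)
    (hne : ∃ d ∈ N.divisors, X d ≠ X' d) :
    ∃ z : ℂ, 0 < z.im ∧
      (∏ d ∈ N.divisors, dedekindEta (d * z) ^ X d) ≠
        ∏ d ∈ N.divisors, dedekindEta (d * z) ^ X' d := by
  by_contra! heq
  obtain ⟨d, hd, hXd⟩ := hne
  have hpos : ∀ d ∈ N.divisors, 0 < d := fun d hd ↦ Nat.pos_of_mem_divisors hd
  refine hXd ?_
  have := eq_zero_of_log_add_sum_logNormEulerProduct_eq_zero hpos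
    (∑ d ∈ N.divisors, ((X d : ℝ) - X' d) * (d / 24)) (fun d ↦ (X d : ℝ) - X' d) ?_ d hd
  · exact_mod_cast sub_eq_zero.1 this
  intro x hx hx1
  have hz : 0 < (I * (-Real.log x / (2 * Real.pi) : ℝ)).im := by
    have : 0 < -Real.log x / (2 * Real.pi) :=
      div_pos (neg_pos.2 (Real.log_neg hx hx1)) (by positivity)
    simpa only [Complex.I_mul_im, Complex.ofReal_re]
  have hlog := congrArg (fun w : ℂ ↦ Real.log ‖w‖) (heq _ hz)
  simp only [log_norm_prod_dedekindEta_zpow hpos _ hz] at hlog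
  rw [← sub_eq_zero, ← Finset.sum_sub_distrib] at hlog
  rw [Finset.sum_mul, ← Finset.sum_add_distrib, ← hlog]
  refine Finset.sum_congr rfl fun d hd ↦ ?_
  rw [log_norm_dedekindEta hx hx1 (hpos d hd)]
  ring
end

section
/- Every primitive holomorphic eta quotient of weight 1/2 whose level divides 4 is one of the following six eta quotients: η, η²/η₂, η₂²/η, η₂³/(η·η₄), η₂⁵/(η²·η₄²), η·η₄/η₂. Equivalently: if X : D_4 → ℤ satisfies X_1 + X_2 + X_4 = 1, gcd{d : X_d ≠ 0} = 1, and Σ_{d|4} (4·gcd(d,t)²)/(d·gcd(t²,4))·X_d ≥ 0 for every t ∈ {1,2,4}, then (X_1, X_2, X_4) is one of (1,0,0), (2,−1,0), (−1,2,0), (−1,3,−1), (−2,5,−2), (1,−1,1). -/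
open Finset

/-- `24` times the order of the eta quotient `η^X` at the cusp `1/t` of `Γ₀(N)`:
`∑_{d ∣ N} (N · gcd(d,t)²)/(d · gcd(t²,N)) · X_d`. -/
def etaOrd (N : ℕ) (X : ℕ → ℤ) (t : ℕ) : ℚ :=
  ∑ d ∈ N.divisors,
    ((N : ℚ) * (Nat.gcd d t : ℚ) ^ 2 / ((d : ℚ) * (Nat.gcd (t ^ 2) N : ℚ))) * (X d : ℚ)

/-- The eta quotient `η^X` on `Γ₀(N)` is holomorphic: all cusp orders are nonnegative. -/
def IsHolEta (N : ℕ) (X : ℕ → ℤ) : Prop :=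
  ∀ t ∈ N.divisors, 0 ≤ etaOrd N X t

/-- The exponent vector `X` is supported on the divisors of `N`, i.e. `X : D_N → ℤ`. -/
def SuppIn (N : ℕ) (X : ℕ → ℤ) : Prop :=
  ∀ d : ℕ, ¬ d ∣ N → X d = 0

/-- The eta quotient `η^X` is primitive: `gcd {d ∣ N : X_d ≠ 0} = 1`. -/
def IsPrimitiveEta (N : ℕ) (X : ℕ → ℤ) : Prop :=
  (N.divisors.filter fun d => X d ≠ 0).gcd id = 1

/-- The primitive holomorphic eta quotients of weight `1/2` on `Γ₀(4)` are exactly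
η, η²/η₂, η₂²/η, η₂³/(η·η₄), η₂⁵/(η²·η₄²), η·η₄/η₂, i.e. the exponent vector
`(X₁, X₂, X₄)` is one of `(1,0,0), (2,−1,0), (−1,2,0), (−1,3,−1), (−2,5,−2), (1,−1,1)`. -/
theorem primitive_weight_half_on_gamma0_four (X : ℕ → ℤ)
    (hsupp : SuppIn 4 X)
    (hwt : X 1 + X 2 + X 4 = 1)
    (hprim : IsPrimitiveEta 4 X)
    (hhol : IsHolEta 4 X) :
    (X 1 = 1 ∧ X 2 = 0 ∧ X 4 = 0) ∨
    (X 1 = 2 ∧ X 2 = -1 ∧ X 4 = 0) ∨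
    (X 1 = -1 ∧ X 2 = 2 ∧ X 4 = 0) ∨
    (X 1 = -1 ∧ X 2 = 3 ∧ X 4 = -1) ∨
    (X 1 = -2 ∧ X 2 = 5 ∧ X 4 = -2) ∨
    (X 1 = 1 ∧ X 2 = -1 ∧ X 4 = 1) := by
  have hdiv : Nat.divisors 4 = {1, 2, 4} := by decide
  have hX1 : X 1 ≠ 0 := by
    intro h0
    have htwo : 2 ∣ (({1, 2, 4} : Finset ℕ).filter fun d => X d ≠ 0).gcd id := by
      refine Finset.dvd_gcd fun d hd => ?_
      simp only [mem_filter, mem_insert, mem_singleton] at hd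
      obtain ⟨rfl | rfl | rfl, hd⟩ := hd
      · exact absurd h0 hd
      · norm_num
      · norm_num
    rw [← hdiv, hprim] at htwo
    norm_num at htwo
  have hord1 := hhol 1 (by decide)
  have hord2 := hhol 2 (by decide)
  have hord4 := hhol 4 (by decide)
  simp only [etaOrd, hdiv, mem_insert, mem_singleton, OfNat.one_ne_ofNat,
    sum_insert, sum_singleton, not_false_eq_true, or_self, Nat.reduceEqDiff]
    at hord1 hord2 hord4
  norm_num at hord1 hord2 hord4
  have hcusp1 : 0 ≤ 4 * X 1 + 2 * X 2 + X 4 := by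
    have : (0 : ℚ) ≤ 4 * X 1 + 2 * X 2 + X 4 := by linarith
    exact_mod_cast this
  have hcusp2 : 0 ≤ X 1 + 2 * X 2 + X 4 := by
    have : (0 : ℚ) ≤ X 1 + 2 * X 2 + X 4 := by linarith
    exact_mod_cast this
  have hcusp4 : 0 ≤ X 1 + 2 * X 2 + 4 * X 4 := by
    have : (0 : ℚ) ≤ X 1 + 2 * X 2 + 4 * X 4 := by linarith
    exact_mod_cast this
  omega
end

section
/- For every z in the upper half plane, η(z) = Σ_{n=1}^{∞} χ₁₂(n)·e^{2πi n² z/24}, where χ₁₂ is the real Dirichlet character modulo 12 given by χ₁₂(n) = 1 if n ≡ ±1 (mod 12), χ₁₂(n) = −1 if n ≡ ±5 (mod 12), and χ₁₂(n) = 0 otherwise. -/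
open Complex

/-- The real Dirichlet character mod `12`: `χ₁₂(n) = 1` if `n ≡ ±1 (mod 12)`,
`χ₁₂(n) = −1` if `n ≡ ±5 (mod 12)`, and `χ₁₂(n) = 0` otherwise. -/
def chi12 (n : ℕ) : ℤ :=
  if n % 12 = 1 ∨ n % 12 = 11 then 1
  else if n % 12 = 5 ∨ n % 12 = 7 then -1
  else 0

open Filter Topology

theorem norm_prod_one_sub_pow_le {x : ℂ} (hx : ‖x‖ < 1) (k n : ℕ) :
    ‖∏ i ∈ Finset.range n, (1 - x ^ (k + i + 1))‖ ≤ Real.exp (1 - ‖x‖)⁻¹ := by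
  have hgeom := summable_geometric_of_lt_one (norm_nonneg x) hx
  calc ‖∏ i ∈ Finset.range n, (1 - x ^ (k + i + 1))‖
      = ∏ i ∈ Finset.range n, ‖1 - x ^ (k + i + 1)‖ := norm_prod _ _
    _ ≤ ∏ i ∈ Finset.range n, Real.exp (‖x‖ ^ i) := by
        refine Finset.prod_le_prod (fun _ _ ↦ norm_nonneg _) fun i _ ↦ ?_
        calc ‖1 - x ^ (k + i + 1)‖ ≤ 1 + ‖x‖ ^ (k + i + 1) := by
              simpa using norm_sub_le (1 : ℂ) (x ^ (k + i + 1))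
          _ ≤ ‖x‖ ^ i + 1 := by
              rw [add_comm]
              gcongr ?_ + 1
              exact pow_le_pow_of_le_one (norm_nonneg x) hx.le (by omega)
          _ ≤ _ := Real.add_one_le_exp _
    _ = Real.exp (∑ i ∈ Finset.range n, ‖x‖ ^ i) := (Real.exp_sum _ _).symm
    _ ≤ Real.exp (1 - ‖x‖)⁻¹ := by
        rw [← tsum_geometric_of_lt_one (norm_nonneg x) hx]
        gcongr
        exact hgeom.sum_le_tsum _ fun i _ ↦ by positivity

theorem norm_pow_mul_prod_one_sub_pow_le {x : ℂ} (hx : ‖x‖ < 1) (k n : ℕ) :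
    ‖x ^ ((k + 1) * n) * ∏ i ∈ Finset.range (n + 1), (1 - x ^ (k + i + 1))‖ ≤
      ‖x‖ ^ n * Real.exp (1 - ‖x‖)⁻¹ := by
  rw [norm_mul, norm_pow]
  exact mul_le_mul (pow_le_pow_of_le_one (norm_nonneg x) hx.le (by nlinarith))
    (norm_prod_one_sub_pow_le hx k (n + 1)) (norm_nonneg _) (by positivity)

/-- **Pentagonal number theorem** on the open unit disc. -/
theorem Complex.tprod_one_sub_pow_eq_tsum_pentagonal {x : ℂ} (hx : ‖x‖ < 1) :
    ∏' n : ℕ, (1 - x ^ (n + 1)) =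
      ∑' k : ℕ, (-1) ^ k * (x ^ pentagonal (-k) - x ^ pentagonal (k + 1)) := by
  have hgeom := summable_geometric_of_lt_one (norm_nonneg x) hx
  have hbound := hgeom.mul_right (Real.exp (1 - ‖x‖)⁻¹)
  refine Pentagonal.tprod_one_sub_pow (tendsto_pow_atTop_nhds_zero_of_norm_lt_one hx)
    (fun k ↦ hbound.of_norm_bounded (norm_pow_mul_prod_one_sub_pow_le hx k))
    (fun k ↦ ?_) ?_ ?_
  · simp_rw [sub_eq_add_neg]
    refine multipliable_one_add_of_summable ?_
    simpa [add_assoc] using (summable_nat_add_iff (k + 1)).mpr hgeom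
  · refine (hgeom.mul_left 2).of_norm_bounded fun k ↦ ?_
    have hneg : k ≤ pentagonal (-k) := by
      have := two_mul_natCast_pentagonal_neg (k : ℤ)
      zify; nlinarith
    have hpos : k ≤ pentagonal (k + 1) := by
      have := two_mul_natCast_pentagonal (k + 1 : ℤ)
      zify; nlinarith
    calc ‖(-1) ^ k * (x ^ pentagonal (-k) - x ^ pentagonal (k + 1))‖
        ≤ ‖x‖ ^ pentagonal (-k) + ‖x‖ ^ pentagonal (k + 1) := by
          simpa using norm_sub_le (x ^ pentagonal (-k)) (x ^ pentagonal (k + 1))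
      _ ≤ ‖x‖ ^ k + ‖x‖ ^ k := add_le_add
          (pow_le_pow_of_le_one (norm_nonneg x) hx.le hneg)
          (pow_le_pow_of_le_one (norm_nonneg x) hx.le hpos)
      _ = 2 * ‖x‖ ^ k := by ring
  · refine squeeze_zero_norm
      (a := fun k ↦ ‖x‖ ^ k * ∑' n, ‖x‖ ^ n * Real.exp (1 - ‖x‖)⁻¹) (fun k ↦ ?_) ?_
    · rw [norm_mul, norm_mul, norm_pow, norm_pow, norm_neg, norm_one, one_pow, one_mul]
      refine mul_le_mul ?_ ?_ (norm_nonneg _) (by positivity)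
      · refine pow_le_pow_of_le_one (norm_nonneg x) hx.le ?_
        rw [Nat.le_div_iff_mul_le two_pos]
        nlinarith
      · exact tsum_of_norm_bounded hbound.hasSum (norm_pow_mul_prod_one_sub_pow_le hx k)
    · simpa using (tendsto_pow_atTop_nhds_zero_of_lt_one (norm_nonneg x) hx).mul_const _

theorem chi12_one_add_six_mul (k : ℕ) : chi12 (1 + 6 * k) = (-1) ^ k := by
  rcases Nat.even_or_odd' k with ⟨m, rfl | rfl⟩
  · rw [chi12, if_pos (by omega), (even_two_mul m).neg_one_pow]
  · rw [chi12, if_neg (by omega), if_pos (by omega), (odd_two_mul_add_one m).neg_one_pow]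

theorem chi12_five_add_six_mul (k : ℕ) : chi12 (5 + 6 * k) = -(-1) ^ k := by
  rcases Nat.even_or_odd' k with ⟨m, rfl | rfl⟩
  · rw [chi12, if_neg (by omega), if_pos (by omega), (even_two_mul m).neg_one_pow]
  · rw [chi12, if_pos (by omega), (odd_two_mul_add_one m).neg_one_pow, neg_neg]

theorem norm_chi12_le_one (n : ℕ) : ‖(chi12 n : ℂ)‖ ≤ 1 := by
  unfold chi12
  split_ifs <;> simp

theorem chi12_eq_zero {n : ℕ} (h₁ : n % 6 ≠ 1) (h₅ : n % 6 ≠ 5) : chi12 n = 0 := by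
  rw [chi12, if_neg (by omega), if_neg (by omega)]

theorem summable_chi12_mul_pow_sq {w : ℂ} (hw : ‖w‖ < 1) :
    Summable fun n : ℕ ↦ (chi12 n : ℂ) * w ^ n ^ 2 := by
  refine (summable_geometric_of_lt_one (norm_nonneg w) hw).of_norm_bounded fun n ↦ ?_
  rw [norm_mul, norm_pow, ← one_mul (‖w‖ ^ n)]
  exact mul_le_mul (norm_chi12_le_one n)
    (pow_le_pow_of_le_one (norm_nonneg w) hw.le (Nat.le_self_pow two_ne_zero n))
    (by positivity) zero_le_one

theorem tsum_chi12_mul_pow_sq {w : ℂ} (hw : ‖w‖ < 1) :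
    ∑' n : ℕ, (chi12 n : ℂ) * w ^ n ^ 2 =
      ∑' k : ℕ, (-1) ^ k * (w ^ (1 + 6 * k) ^ 2 - w ^ (5 + 6 * k) ^ 2) := by
  have hsum := summable_chi12_mul_pow_sq hw
  have hzero (j : ℕ) (h₁ : j % 6 ≠ 1) (h₅ : j % 6 ≠ 5) :
      ∑' m : ℕ, (chi12 (j + 6 * m) : ℂ) * w ^ (j + 6 * m) ^ 2 = 0 := by
    have (m : ℕ) : chi12 (j + 6 * m) = 0 := chi12_eq_zero (by omega) (by omega)
    simp [this]
  have hclass (j : ℕ) : Summable fun m : ℕ ↦ (chi12 (j + 6 * m) : ℂ) * w ^ (j + 6 * m) ^ 2 :=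
    hsum.comp_injective (i := fun m ↦ j + 6 * m) fun a b h ↦ by simpa using h
  rw [Nat.sumByResidueClasses hsum 6]
  change ∑ j : Fin 6, ∑' m : ℕ, (chi12 (j.val + 6 * m) : ℂ) * w ^ (j.val + 6 * m) ^ 2 = _
  rw [Fin.sum_univ_six]
  change ∑' m : ℕ, (chi12 (0 + 6 * m) : ℂ) * w ^ (0 + 6 * m) ^ 2 +
    ∑' m : ℕ, (chi12 (1 + 6 * m) : ℂ) * w ^ (1 + 6 * m) ^ 2 +
    ∑' m : ℕ, (chi12 (2 + 6 * m) : ℂ) * w ^ (2 + 6 * m) ^ 2 +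
    ∑' m : ℕ, (chi12 (3 + 6 * m) : ℂ) * w ^ (3 + 6 * m) ^ 2 +
    ∑' m : ℕ, (chi12 (4 + 6 * m) : ℂ) * w ^ (4 + 6 * m) ^ 2 +
    ∑' m : ℕ, (chi12 (5 + 6 * m) : ℂ) * w ^ (5 + 6 * m) ^ 2 = _
  rw [hzero 0 (by simp) (by simp), hzero 2 (by simp) (by simp), hzero 3 (by simp) (by simp),
    hzero 4 (by simp) (by simp), zero_add, add_zero, add_zero, add_zero,
    ← (hclass 1).tsum_add (hclass 5)]
  refine tsum_congr fun k ↦ ?_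
  rw [chi12_one_add_six_mul, chi12_five_add_six_mul]
  push_cast
  ring

theorem mul_tprod_one_sub_pow_eq_tsum_chi12 {w : ℂ} (hw : ‖w‖ < 1) :
    w * ∏' n : ℕ, (1 - (w ^ 24) ^ (n + 1)) = ∑' n : ℕ, (chi12 n : ℂ) * w ^ n ^ 2 := by
  have hw24 : ‖w ^ 24‖ < 1 := by
    rw [norm_pow]
    exact pow_lt_one₀ (norm_nonneg w) hw (by norm_num)
  rw [tsum_chi12_mul_pow_sq hw, Complex.tprod_one_sub_pow_eq_tsum_pentagonal hw24, ← tsum_mul_left]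
  refine tsum_congr fun k ↦ ?_
  have hneg : (1 + 6 * k) ^ 2 = 24 * pentagonal (-k) + 1 := by
    have := two_mul_natCast_pentagonal_neg (k : ℤ)
    zify; linear_combination -12 * this
  have hpos : (5 + 6 * k) ^ 2 = 24 * pentagonal (k + 1) + 1 := by
    have := two_mul_natCast_pentagonal (k + 1 : ℤ)
    zify; linear_combination -12 * this
  rw [hneg, hpos, pow_succ w (24 * _), pow_succ w (24 * _), pow_mul, pow_mul]
  ring

/-- The theta series expansion of the Dedekind eta function:
`η(z) = ∑_{n≥1} χ₁₂(n)·e^{2πin²z/24}` (the `n = 0` term vanishes, as `χ₁₂(0) = 0`). -/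
theorem dedekindEta_eq_theta_series (z : ℂ) (hz : 0 < z.im) :
    dedekindEta z =
      ∑' n : ℕ, (chi12 n : ℂ) * Complex.exp (2 * Real.pi * Complex.I * (n : ℂ) ^ 2 * z / 24) := by
  have hw : ‖cexp (2 * Real.pi * I * z / 24)‖ < 1 := by
    rw [norm_exp, Real.exp_lt_one_iff]
    have : (2 * Real.pi * I * z / 24).re = -(Real.pi * z.im / 12) := by
      simp [mul_assoc]
      ring
    rw [this, neg_lt_zero]
    positivity
  rw [dedekindEta]
  convert mul_tprod_one_sub_pow_eq_tsum_chi12 hw using 2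
  · congr 1
    ring
  · refine tprod_congr fun n ↦ ?_
    rw [← exp_nat_mul, ← exp_nat_mul]
    congr 2
    push_cast
    ring
  · ext n
    rw [← exp_nat_mul]
    congr 2
    push_cast
    ring
end

section
/- For every z in the upper half plane, η(2z)²/η(z) = Σ_{n=0}^{∞} e^{2πi(2n+1)² z/8}; equivalently, with q = e^{2πiz}, one has q^{1/8}·∏_{n=1}^{∞}(1−q^{2n})(1+q^{n}) = Σ_{n=0}^{∞} q^{(2n+1)²/8}. -/
open Complex

open Filter Topology

/-- The summands of Shanks' finite form of Gauss' triangular number identity have telescoping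
differences in `n`. -/
lemma shanks_summand_telescope {K : Type*} [Field K] {q : K} {P : ℕ → K}
    (hq : ∀ n : ℕ, 1 - q ^ (n + 1) ≠ 0) (hP : ∀ n, P n ≠ 0)
    (hrec : ∀ n, P (n + 1) * (1 - q ^ (2 * n + 1)) = P n * (1 - q ^ (2 * n + 2))) (n m : ℕ) :
    ∑ s ∈ Finset.range m,
        (P (n + 1) / P s * q ^ (s * (2 * n + 3)) - P n / P s * q ^ (s * (2 * n + 1))) =
      P n / P m * q ^ (m * (2 * n + 1)) * (1 - q ^ (2 * m)) / (1 - q ^ (2 * n + 1)) := by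
  have hn := hq (2 * n)
  have hPn : P (n + 1) = P n * (1 - q ^ (2 * n + 2)) / (1 - q ^ (2 * n + 1)) :=
    eq_div_of_mul_eq hn (hrec n)
  induction m with
  | zero => simp
  | succ m ih =>
    have hm := hq (2 * m)
    have hm' := hq (2 * m + 1)
    have hPm : P (m + 1) = P m * (1 - q ^ (2 * m + 2)) / (1 - q ^ (2 * m + 1)) :=
      eq_div_of_mul_eq hm (hrec m)
    have h0 := hP m
    rw [Finset.sum_range_succ, ih, hPn, hPm]
    have e₁ : q ^ (m * (2 * n + 3)) = q ^ (m * (2 * n + 1)) * q ^ (2 * m) := by ring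
    have e₂ : q ^ ((m + 1) * (2 * n + 1)) = q ^ (m * (2 * n + 1)) * q ^ (2 * n + 1) := by ring
    have e₃ : q ^ (2 * (m + 1)) = q ^ (2 * m + 2) := by ring
    rw [e₁, e₂, e₃]
    have hm'' : 1 - q ^ (2 * m + 2) ≠ 0 := hm'
    field_simp
    ring

/-- Shanks' finite form of Gauss' triangular number identity. -/
lemma shanks_identity {K : Type*} [Field K] {q : K} {P : ℕ → K}
    (hq : ∀ n : ℕ, 1 - q ^ (n + 1) ≠ 0) (hP : ∀ n, P n ≠ 0)
    (hrec : ∀ n, P (n + 1) * (1 - q ^ (2 * n + 1)) = P n * (1 - q ^ (2 * n + 2))) (n : ℕ) :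
    ∑ s ∈ Finset.range n, P n / P s * q ^ (s * (2 * n + 1)) =
      ∑ s ∈ Finset.range (2 * n), q ^ (s * (s + 1) / 2) := by
  induction n with
  | zero => simp
  | succ n ih =>
    have h := shanks_summand_telescope hq hP hrec n n
    rw [Finset.sum_sub_distrib, ih, sub_eq_iff_eq_add] at h
    have hn := hq (2 * n)
    have h0 := hP n
    have hPn : P (n + 1) = P n * (1 - q ^ (2 * n + 2)) / (1 - q ^ (2 * n + 1)) :=
      eq_div_of_mul_eq hn (hrec n)
    rw [show 2 * (n + 1) + 1 = 2 * n + 3 by ring, show 2 * (n + 1) = 2 * n + 1 + 1 by ring,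
      Finset.sum_range_succ, h, Finset.sum_range_succ, Finset.sum_range_succ, hPn,
      show 2 * n * (2 * n + 1) / 2 = n * (2 * n + 1) by
        rw [mul_assoc, Nat.mul_div_cancel_left _ two_pos],
      show (2 * n + 1) * (2 * n + 1 + 1) / 2 = n * (2 * n + 1) + (2 * n + 1) by
        rw [show (2 * n + 1) * (2 * n + 1 + 1) = 2 * (n * (2 * n + 1) + (2 * n + 1)) by ring,
          Nat.mul_div_cancel_left _ two_pos],
      show n * (2 * n + 3) = n * (2 * n + 1) + 2 * n by ring]
    field_simp
    ring

lemma one_sub_pow_succ_ne_zero {q : ℂ} (hq : ‖q‖ < 1) (n : ℕ) : 1 - q ^ (n + 1) ≠ 0 := by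
  intro h
  have h' : ‖q ^ (n + 1)‖ = 1 := by rw [← sub_eq_zero.mp h, norm_one]
  rw [norm_pow] at h'
  exact (pow_lt_one₀ (norm_nonneg q) hq n.succ_ne_zero).ne h'

lemma tprod_one_sub_pow_succ_ne_zero {q : ℂ} (hq : ‖q‖ < 1) :
    ∏' n : ℕ, (1 - q ^ (n + 1)) ≠ 0 := by
  simp_rw [sub_eq_add_neg]
  refine tprod_one_add_ne_zero_of_summable (f := fun n ↦ -q ^ (n + 1)) (fun n ↦ ?_) ?_
  · simpa [sub_eq_add_neg] using one_sub_pow_succ_ne_zero hq n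
  · simpa using (summable_nat_add_iff 1).mpr (summable_geometric_of_lt_one (norm_nonneg _) hq)

lemma tendsto_prod_range_one_sub_pow_succ {q : ℂ} (hq : ‖q‖ < 1) :
    Tendsto (fun n ↦ ∏ s ∈ Finset.range n, (1 - q ^ (s + 1))) atTop
      (𝓝 (∏' n : ℕ, (1 - q ^ (n + 1)))) :=
  (ModularForm.multipliable_one_sub_pow hq).hasProd.tendsto_prod_nat

/-- The terms with `1 ≤ s` in Shanks' identity are negligible in the limit. -/
lemma tendsto_shanks_sum {q L : ℂ} (hq : ‖q‖ < 1) {P : ℕ → ℂ} (hP0 : P 0 = 1)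
    (hL : L ≠ 0) (hP : Tendsto P atTop (𝓝 L)) :
    Tendsto (fun n ↦ ∑ s ∈ Finset.range n, P n / P s * q ^ (s * (2 * n + 1))) atTop (𝓝 L) := by
  obtain ⟨A, hA⟩ := hP.norm.bddAbove_range
  obtain ⟨B, hB⟩ := (hP.inv₀ hL).norm.bddAbove_range
  replace hA : ∀ n, ‖P n‖ ≤ A := fun n ↦ hA ⟨n, rfl⟩
  replace hB : ∀ n, ‖(P n)⁻¹‖ ≤ B := fun n ↦ hB ⟨n, rfl⟩
  have hA0 : 0 ≤ A := (norm_nonneg _).trans (hA 0)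
  have hB0 : 0 ≤ B := (norm_nonneg _).trans (hB 0)
  rw [← tendsto_add_atTop_iff_nat 1] at hP ⊢
  simp_rw [Finset.sum_range_succ']
  have hmain : Tendsto (fun n ↦ P (n + 1) / P 0 * q ^ (0 * (2 * (n + 1) + 1))) atTop (𝓝 L) := by
    simpa [hP0] using hP
  have hrest : Tendsto (fun n ↦ ∑ s ∈ Finset.range n,
      P (n + 1) / P (s + 1) * q ^ ((s + 1) * (2 * (n + 1) + 1))) atTop (𝓝 0) := by
    have hlim : Tendsto (fun n : ℕ ↦ A * B * (n * ‖q‖ ^ n)) atTop (𝓝 0) := by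
      simpa using (tendsto_self_mul_const_pow_of_lt_one (norm_nonneg q) hq).const_mul (A * B)
    refine squeeze_zero_norm (fun n ↦ ?_) hlim
    calc _ ≤ ∑ s ∈ Finset.range n, A * B * ‖q‖ ^ n := by
          refine norm_sum_le_of_le _ fun s _ ↦ ?_
          rw [norm_mul, div_eq_mul_inv, norm_mul, norm_pow]
          refine mul_le_mul (mul_le_mul ?_ ?_ (norm_nonneg _) hA0) ?_ (by positivity)
            (by positivity)
          · exact hA _
          · exact hB _
          · exact pow_le_pow_of_le_one (norm_nonneg q) hq.le (by nlinarith)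
      _ = A * B * (n * ‖q‖ ^ n) := by
          rw [Finset.sum_const, Finset.card_range, nsmul_eq_mul]
          ring
  simpa using hrest.add hmain

lemma summable_pow_triangular {q : ℂ} (hq : ‖q‖ < 1) :
    Summable fun n : ℕ ↦ q ^ (n * (n + 1) / 2) := by
  refine .of_norm_bounded (summable_geometric_of_lt_one (norm_nonneg q) hq) fun n ↦ ?_
  rw [norm_pow]
  refine pow_le_pow_of_le_one (norm_nonneg q) hq.le ?_
  rw [Nat.le_div_iff_mul_le two_pos]
  rcases n with _ | n
  · simp
  · gcongr
    omega

/-- **Gauss' triangular number identity**. -/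
theorem tprod_sq_div_tprod_eq_tsum_pow_triangular {q : ℂ} (hq : ‖q‖ < 1) :
    (∏' n : ℕ, (1 - (q ^ 2) ^ (n + 1))) ^ 2 / ∏' n : ℕ, (1 - q ^ (n + 1)) =
      ∑' n : ℕ, q ^ (n * (n + 1) / 2) := by
  have hq2 : ‖q ^ 2‖ < 1 := by
    rw [norm_pow]
    exact pow_lt_one₀ (norm_nonneg q) hq two_ne_zero
  have htwo : Tendsto (fun n : ℕ ↦ 2 * n) atTop atTop := tendsto_id.const_mul_atTop' two_pos
  set P : ℕ → ℂ := fun n ↦ (∏ s ∈ Finset.range n, (1 - (q ^ 2) ^ (s + 1))) ^ 2 /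
    ∏ s ∈ Finset.range (2 * n), (1 - q ^ (s + 1)) with hPdef
  have hprod (n : ℕ) : ∏ s ∈ Finset.range n, (1 - q ^ (s + 1)) ≠ 0 :=
    Finset.prod_ne_zero_iff.mpr fun s _ ↦ one_sub_pow_succ_ne_zero hq s
  have hprod2 (n : ℕ) : ∏ s ∈ Finset.range n, (1 - (q ^ 2) ^ (s + 1)) ≠ 0 :=
    Finset.prod_ne_zero_iff.mpr fun s _ ↦ one_sub_pow_succ_ne_zero hq2 s
  have hP (n : ℕ) : P n ≠ 0 := div_ne_zero (pow_ne_zero 2 (hprod2 n)) (hprod _)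
  have hrec (n : ℕ) : P (n + 1) * (1 - q ^ (2 * n + 1)) = P n * (1 - q ^ (2 * n + 2)) := by
    have h₁ := one_sub_pow_succ_ne_zero hq (2 * n)
    have h₂ : 1 - q ^ (2 * n + 2) ≠ 0 := one_sub_pow_succ_ne_zero hq (2 * n + 1)
    have h₃ := hprod (2 * n)
    simp only [hPdef, show 2 * (n + 1) = 2 * n + 1 + 1 by ring, Finset.prod_range_succ,
      ← pow_mul q 2 (n + 1), show 2 * n + 1 + 1 = 2 * n + 2 by ring]
    field_simp
  have hlim : Tendsto P atTop (𝓝 ((∏' n : ℕ, (1 - (q ^ 2) ^ (n + 1))) ^ 2 /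
      ∏' n : ℕ, (1 - q ^ (n + 1)))) :=
    ((tendsto_prod_range_one_sub_pow_succ hq2).pow 2).div
      ((tendsto_prod_range_one_sub_pow_succ hq).comp htwo) (tprod_one_sub_pow_succ_ne_zero hq)
  have hsum := tendsto_shanks_sum hq (by simp [hPdef])
    (div_ne_zero (pow_ne_zero 2 (tprod_one_sub_pow_succ_ne_zero hq2))
      (tprod_one_sub_pow_succ_ne_zero hq)) hlim
  simp_rw [shanks_identity (one_sub_pow_succ_ne_zero hq) hP hrec] at hsum
  exact tendsto_nhds_unique hsum
    ((summable_pow_triangular hq).hasSum.tendsto_sum_nat.comp htwo)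

lemma dedekindEta_eq (z : ℂ) :
    dedekindEta z = exp (Real.pi * I * z / 12) *
      ∏' n : ℕ, (1 - exp (2 * Real.pi * I * z) ^ (n + 1)) := by
  rw [dedekindEta]
  congr! 4 with n
  rw [← exp_nat_mul]
  congr 1
  push_cast
  ring

/-- The theta series expansion of `η₂²/η`:
`η(2z)²/η(z) = ∑_{n≥0} e^{2πi(2n+1)²z/8}` for all `z` in the upper half plane. -/
theorem eta_two_sq_div_eta_eq_theta_series (z : ℂ) (hz : 0 < z.im) :
    dedekindEta (2 * z) ^ 2 / dedekindEta z =
      ∑' n : ℕ, Complex.exp (2 * Real.pi * Complex.I * (2 * (n : ℂ) + 1) ^ 2 * z / 8) := by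
  have hq : ‖exp (2 * Real.pi * I * z)‖ < 1 :=
    UpperHalfPlane.norm_exp_two_pi_I_lt_one ⟨z, hz⟩
  have hterm (n : ℕ) : exp (2 * Real.pi * I * (2 * (n : ℂ) + 1) ^ 2 * z / 8) =
      exp (Real.pi * I * z / 4) * exp (2 * Real.pi * I * z) ^ (n * (n + 1) / 2) := by
    rw [← exp_nat_mul, ← exp_add,
      Nat.cast_div (Nat.even_mul_succ_self n).two_dvd (by norm_num)]
    congr 1
    push_cast
    ring
  have hfactor : exp (Real.pi * I * (2 * z) / 12) ^ 2 / exp (Real.pi * I * z / 12) =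
      exp (Real.pi * I * z / 4) := by
    rw [← exp_nat_mul, ← exp_sub]
    congr 1
    push_cast
    ring
  have hsq : exp (2 * Real.pi * I * (2 * z)) = exp (2 * Real.pi * I * z) ^ 2 := by
    rw [← exp_nat_mul]
    congr 1
    push_cast
    ring
  simp_rw [hterm]
  rw [tsum_mul_left, ← tprod_sq_div_tprod_eq_tsum_pow_triangular hq, ← hfactor, dedekindEta_eq,
    dedekindEta_eq, hsq, mul_pow, mul_div_mul_comm]
end
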